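/- arXiv:1003.5996 — 4 statements merged into one kernel-verified Lean document; each statement's English description precedes it below -/
import Mathlib

section
/- Let k ≥ 1 be a natural number and let a_1, a_0, b_1, b_0 be real numbers such that a_1·N + a_0 > 0 and b_1·N + b_0 > 0 for every natural number N ≥ 1. Then, as N → ∞, I_k(N; a_1·N + a_0, b_1·N + b_0)/N converges to (1+a_1)/(k·(2+a_1+b_1)^k) · Σ_{j=0}^{k−1} (−1)^j · ((1+a_1)/(2+a_1+b_1))^j · binom(j+k−1, j) · Σ_{i=0}^{k−1−j} (1+a_1)^i · binom(k, i+j+1) · binom(k, i). -/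
open Finset MeasureTheory

/-- The Jacobi-ensemble average `⟨f⟩_{a,b}` over `[0,1]^N`. -/
noncomputable def jacobiAvg (N : ℕ) (a b : ℝ) (f : (Fin N → ℝ) → ℝ) : ℝ :=
  ((N.factorial : ℝ))⁻¹ *
    ∫ x in Set.univ.pi (fun _ : Fin N => Set.Icc (0 : ℝ) 1),
      f x * (∏ i, ∏ j ∈ Finset.Ioi i, (x i - x j) ^ 2) *
        ∏ i, x i ^ (a - 1) * (1 - x i) ^ (b - 1)

/-- `I_k = ⟨p_k⟩_{a,b} / ⟨1⟩_{a,b}` where `p_k` is the `k`-th power sum. -/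
noncomputable def Ik (k N : ℕ) (a b : ℝ) : ℝ :=
  jacobiAvg N a b (fun x => ∑ i, x i ^ k) / jacobiAvg N a b (fun _ => 1)

open PowerSeries in
/-- The linear map `H ↦ H(D)`, where `D = z φ(D)`, given coefficientwise by the
Lagrange–Bürmann formula. -/
noncomputable def lagrangeTransform (φ : PowerSeries ℝ) : PowerSeries ℝ →ₗ[ℝ] PowerSeries ℝ where
  toFun H := PowerSeries.mk fun n => coeff n (H * (φ ^ n * (1 - X * (d⁄dX ℝ φ) * φ⁻¹)))
  map_add' F G := by ext n; simp [add_mul]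
  map_smul' c F := by ext n; simp

namespace lagrangeTransform

open PowerSeries

theorem coeff_eq (φ H : ℝ⟦X⟧) (n : ℕ) : coeff n (lagrangeTransform φ H) =
    coeff n (H * (φ ^ n * (1 - X * (d⁄dX ℝ φ) * φ⁻¹))) := by
  simp [lagrangeTransform]

theorem succ_mul_coeff_X_mul_derivative (φ : ℝ⟦X⟧) (n k : ℕ) :
    ((n : ℝ) + 1) * coeff k (X * (φ ^ n * d⁄dX ℝ φ)) = k * coeff k (φ ^ (n + 1)) := by
  have h : d⁄dX ℝ (φ ^ (n + 1)) = ((n : ℝ) + 1) • (φ ^ n * d⁄dX ℝ φ) := by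
    rw [Derivation.leibniz_pow]
    simp only [add_tsub_cancel_right, smul_eq_mul]
    rw [← Nat.cast_smul_eq_nsmul ℝ]
    push_cast
    rfl
  cases k with
  | zero => simp
  | succ k =>
    have h2 := congrArg (coeff k) h
    rw [coeff_derivative] at h2
    rw [coeff_succ_X_mul]
    simp only [map_smul, smul_eq_mul] at h2
    push_cast
    linarith

theorem pow_succ_mul (φ : ℝ⟦X⟧) (hφ : constantCoeff φ ≠ 0) (n : ℕ) :
    φ ^ (n + 1) * (1 - X * (d⁄dX ℝ φ) * φ⁻¹) = φ ^ (n + 1) - X * (φ ^ n * d⁄dX ℝ φ) := by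
  have h := PowerSeries.mul_inv_cancel φ hφ
  linear_combination (-X * (d⁄dX ℝ φ) * φ ^ n) * h

theorem X_mul (φ : ℝ⟦X⟧) (H : ℝ⟦X⟧) :
    lagrangeTransform φ (X * H) = X * lagrangeTransform φ (φ * H) := by
  ext n
  cases n with
  | zero => simp [coeff_eq]
  | succ n =>
    rw [coeff_succ_X_mul, coeff_eq, coeff_eq, mul_assoc, coeff_succ_X_mul]
    congr 1
    ring

theorem one (φ : ℝ⟦X⟧) (hφ : constantCoeff φ ≠ 0) : lagrangeTransform φ 1 = 1 := by
  ext n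
  cases n with
  | zero => simp [coeff_eq]
  | succ n =>
    rw [coeff_eq, one_mul, pow_succ_mul φ hφ, map_sub, coeff_one, if_neg (Nat.succ_ne_zero n)]
    have h := succ_mul_coeff_X_mul_derivative φ n (n + 1)
    push_cast at h
    rw [sub_eq_zero]
    exact (mul_left_cancel₀ (by positivity) h).symm

theorem mul (φ : ℝ⟦X⟧) (hφ : constantCoeff φ ≠ 0) (F G : ℝ⟦X⟧) :
    lagrangeTransform φ (F * G) = lagrangeTransform φ F * lagrangeTransform φ G := by
  have key : ∀ n : ℕ, ∀ F : ℝ⟦X⟧, X ^ n ∣ lagrangeTransform φ (F * G) -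
      lagrangeTransform φ F * lagrangeTransform φ G := by
    intro n
    induction n with
    | zero => simp
    | succ n ih =>
      intro F
      obtain ⟨c, H, rfl⟩ : ∃ (c : ℝ) (H : ℝ⟦X⟧), F = c • (1 : ℝ⟦X⟧) + X * H := by
        refine ⟨constantCoeff F, mk fun p => coeff (p + 1) F, ?_⟩
        rw [smul_eq_C_mul, mul_one, add_comm]
        exact eq_X_mul_shift_add_const F
      obtain ⟨R, hR⟩ := ih (φ * H)
      refine ⟨R, ?_⟩
      rw [add_mul, map_add, map_add, smul_mul_assoc, map_smul, map_smul, one φ hφ, one_mul,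
        mul_assoc, X_mul, X_mul, ← mul_assoc, add_mul, smul_mul_assoc, one_mul, pow_succ']
      linear_combination X * hR
  rw [← sub_eq_zero]
  ext n
  simpa using X_pow_dvd_iff.1 (key (n + 1) F) n (Nat.lt_succ_self n)

theorem succ_mul_coeff_X (φ : ℝ⟦X⟧) (hφ : constantCoeff φ ≠ 0) (n : ℕ) :
    ((n : ℝ) + 1) * coeff (n + 1) (lagrangeTransform φ X) = coeff n (φ ^ (n + 1)) := by
  have h := succ_mul_coeff_X_mul_derivative φ n n
  rw [coeff_eq, coeff_succ_X_mul, pow_succ_mul φ hφ, map_sub]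
  linarith

end lagrangeTransform

section LimitMoments

open PowerSeries

/-- The Lagrange kernel `(1 + u) (A + u) / (s + u)`. -/
noncomputable def jacobiKernel (A s : ℝ) : ℝ⟦X⟧ := (C s + X)⁻¹ * ((X + C 1) * (X + C A))

/-- The limiting normalized moments of the Jacobi ensemble. -/
noncomputable def limitMoment (A s : ℝ) (n : ℕ) : ℝ :=
  coeff n (1 + lagrangeTransform (jacobiKernel A s) X)

theorem constantCoeff_jacobiKernel {A s : ℝ} (hA : A ≠ 0) (hs : s ≠ 0) :
    constantCoeff (jacobiKernel A s) ≠ 0 := by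
  simp [jacobiKernel, hA, hs]

theorem C_add_X_mul_jacobiKernel {A s : ℝ} (hs : s ≠ 0) :
    (C s + X) * jacobiKernel A s = (X + C 1) * (X + C A) := by
  rw [jacobiKernel, ← mul_assoc, PowerSeries.mul_inv_cancel _ (by simpa using hs), one_mul]

theorem coeff_zero_lagrangeTransform_X (φ : ℝ⟦X⟧) :
    coeff 0 (lagrangeTransform φ X) = 0 := by
  simp [lagrangeTransform.coeff_eq]

theorem limitMoment_zero (A s : ℝ) : limitMoment A s 0 = 1 := by
  rw [limitMoment, map_add, coeff_zero_lagrangeTransform_X]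
  simp

theorem limitMoment_succ (A s : ℝ) (n : ℕ) :
    limitMoment A s (n + 1) = coeff (n + 1) (lagrangeTransform (jacobiKernel A s) X) := by
  rw [limitMoment, map_add, coeff_one, if_neg (Nat.succ_ne_zero n), zero_add]

theorem lagrangeTransform_jacobiKernel_X {A s : ℝ} (hA : A ≠ 0) (hs : s ≠ 0) :
    C s * lagrangeTransform (jacobiKernel A s) X + lagrangeTransform (jacobiKernel A s) X ^ 2 =
      X * ((1 + lagrangeTransform (jacobiKernel A s) X) *
        (C (A - 1) + (1 + lagrangeTransform (jacobiKernel A s) X))) := by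
  have hφ := constantCoeff_jacobiKernel hA hs
  have hC : ∀ r : ℝ, lagrangeTransform (jacobiKernel A s) (C r) = C r := by
    intro r
    have := (lagrangeTransform (jacobiKernel A s)).map_smul r 1
    rwa [lagrangeTransform.one _ hφ, smul_eq_C_mul, mul_one] at this
  have h := lagrangeTransform.X_mul (jacobiKernel A s) (C s + X)
  rw [mul_comm (jacobiKernel A s), C_add_X_mul_jacobiKernel hs, lagrangeTransform.mul _ hφ,
    lagrangeTransform.mul _ hφ, map_add, map_add, map_add, hC, hC, hC] at h
  rw [map_sub, map_one]
  rw [map_one] at h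
  linear_combination h

theorem mul_limitMoment_succ {A s : ℝ} (hA : A ≠ 0) (hs : s ≠ 0) (n : ℕ) :
    s * limitMoment A s (n + 1) =
      (∑ l ∈ range (n + 1), limitMoment A s l * limitMoment A s (n - l)) -
      (∑ l ∈ range n, limitMoment A s (l + 1) * limitMoment A s (n - l)) +
      (A - 1) * limitMoment A s n := by
  have h := congrArg (coeff (n + 1)) (lagrangeTransform_jacobiKernel_X hA hs)
  rw [coeff_succ_X_mul, map_add, mul_add, map_add, mul_comm _ (C (A - 1)), coeff_C_mul, coeff_C_mul,
    ← limitMoment_succ, coeff_mul, pow_two, coeff_mul,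
    Finset.Nat.sum_antidiagonal_eq_sum_range_succ
      (fun i j => coeff i (1 + lagrangeTransform (jacobiKernel A s) X) *
        coeff j (1 + lagrangeTransform (jacobiKernel A s) X)),
    Finset.Nat.sum_antidiagonal_eq_sum_range_succ
      (fun i j => coeff i (lagrangeTransform (jacobiKernel A s) X) *
        coeff j (lagrangeTransform (jacobiKernel A s) X)),
    sum_range_succ, sum_range_succ', coeff_zero_lagrangeTransform_X, Nat.sub_self,
    coeff_zero_lagrangeTransform_X] at h
  have h2 : ∑ l ∈ range n, limitMoment A s (l + 1) * limitMoment A s (n - l) =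
      ∑ l ∈ range n, coeff (l + 1) (lagrangeTransform (jacobiKernel A s) X) *
        coeff (n + 1 - (l + 1)) (lagrangeTransform (jacobiKernel A s) X) := by
    refine sum_congr rfl fun l hl => ?_
    have hl' := mem_range.1 hl
    obtain ⟨m, hm⟩ : ∃ m, n - l = m + 1 := ⟨n - l - 1, by omega⟩
    rw [Nat.add_sub_add_right, hm, limitMoment_succ, limitMoment_succ]
  rw [h2]
  simp only [limitMoment] at h ⊢
  linarith

theorem inv_C_add_X_pow {s : ℝ} (hs : s ≠ 0) (n : ℕ) :
    ((C s + X : ℝ⟦X⟧)⁻¹) ^ (n + 1) =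
      mk fun j => (s ^ (n + 1))⁻¹ * ((-1) ^ j * (s ^ j)⁻¹ * ((n + j).choose n : ℝ)) := by
  have h0 : (C s + X : ℝ⟦X⟧)⁻¹ * (C s + X) = 1 :=
    PowerSeries.inv_mul_cancel _ (by simpa using hs)
  have h1 : (mk fun j => ((n + j).choose n : ℝ)) * (1 - X : ℝ⟦X⟧) ^ (n + 1) = 1 := by
    have := (invOneSubPow ℝ (n + 1)).val_inv
    rwa [invOneSubPow_val_succ_eq_mk_add_choose, invOneSubPow_inv_eq_one_sub_pow] at this
  have h2 := congrArg (rescale (-s⁻¹)) h1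
  have hcc : (C s : ℝ⟦X⟧) * C s⁻¹ = 1 := by
    rw [← map_mul, mul_inv_cancel₀ hs, map_one]
  have h3 : (C s⁻¹ : ℝ⟦X⟧) * (C s + X) = rescale (-s⁻¹) (1 - X) := by
    rw [map_sub, map_one, rescale_X, map_neg]
    linear_combination hcc
  have h4 : (mk fun j => (s ^ (n + 1))⁻¹ * ((-1) ^ j * (s ^ j)⁻¹ * ((n + j).choose n : ℝ))) =
      C s⁻¹ ^ (n + 1) * rescale (-s⁻¹) (mk fun j => ((n + j).choose n : ℝ)) := by
    ext j
    rw [← map_pow, coeff_C_mul, coeff_rescale, coeff_mk, coeff_mk, neg_pow s⁻¹, inv_pow, inv_pow]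
  rw [map_mul, map_pow, ← h3, map_one, mul_pow, ← mul_assoc,
    mul_comm _ (C s⁻¹ ^ (n + 1)), ← h4] at h2
  exact left_inv_eq_right_inv (by rw [← mul_pow, h0, one_pow]) ((mul_comm _ _).trans h2)

theorem coeff_X_add_C_pow (r : ℝ) (n k : ℕ) :
    coeff k ((X + C r : ℝ⟦X⟧) ^ n) = r ^ (n - k) * (n.choose k : ℝ) := by
  rw [← Polynomial.coeff_X_add_C_pow, ← Polynomial.coeff_coe]
  simp

theorem limitMoment_eq {A s : ℝ} (hA : A ≠ 0) (hs : s ≠ 0) {k : ℕ} (hk : 1 ≤ k) :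
    limitMoment A s k = A / ((k : ℝ) * s ^ k) *
      ∑ j ∈ range k, (-1 : ℝ) ^ j * (A / s) ^ j * ((j + k - 1).choose j : ℝ) *
        ∑ i ∈ range (k - j), A ^ i * (k.choose (i + j + 1) : ℝ) * (k.choose i : ℝ) := by
  obtain ⟨n, rfl⟩ : ∃ n, k = n + 1 := ⟨k - 1, by omega⟩
  have hn : (n : ℝ) + 1 ≠ 0 := by positivity
  have h := lagrangeTransform.succ_mul_coeff_X _ (constantCoeff_jacobiKernel hA hs) n
  rw [← limitMoment_succ] at h
  apply mul_left_cancel₀ hn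
  rw [h, jacobiKernel, mul_pow, mul_pow, inv_C_add_X_pow hs, coeff_mul,
    Finset.Nat.sum_antidiagonal_eq_sum_range_succ_mk, mul_sum, mul_sum]
  refine sum_congr rfl fun j hj => ?_
  have hj' := mem_range.1 hj
  rw [coeff_mul, Finset.Nat.sum_antidiagonal_eq_sum_range_succ_mk, mul_sum, mul_sum, mul_sum,
    mul_sum, show n.succ - j = n - j + 1 by omega]
  refine sum_congr rfl fun i hi => ?_
  have hi' := mem_range.1 hi
  simp only [coeff_mk, coeff_X_add_C_pow, one_pow, one_mul]
  rw [show n + 1 - (n - j - i) = i + j + 1 by omega,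
    show (n + 1).choose (n - j - i) = (n + 1).choose (i + j + 1) by
      rw [← Nat.choose_symm (by omega : i + j + 1 ≤ n + 1)]
      congr 1
      omega,
    show j + (n + 1) - 1 = n + j by omega, ← Nat.choose_symm_add, div_pow]
  push_cast
  field_simp
  ring

end LimitMoments

section BetaMoments

open ProbabilityTheory Set

theorem integrableOn_and_integral_beta {a b : ℝ} (ha : 0 < a) (hb : 0 < b) :
    IntegrableOn (fun t : ℝ => t ^ (a - 1) * (1 - t) ^ (b - 1)) (Ioo 0 1) ∧
      ∫ t in Ioo (0 : ℝ) 1, t ^ (a - 1) * (1 - t) ^ (b - 1) = beta a b := by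
  have hβ := beta_pos ha hb
  have h1 := lintegral_betaPDF_eq_one ha hb
  rw [lintegral_betaPDF] at h1
  have hm : Measurable fun t : ℝ => 1 / beta a b * t ^ (a - 1) * (1 - t) ^ (b - 1) := by
    fun_prop
  have hnn : 0 ≤ᵐ[volume.restrict (Ioo (0 : ℝ) 1)]
      fun t : ℝ => 1 / beta a b * t ^ (a - 1) * (1 - t) ^ (b - 1) := by
    refine (ae_restrict_mem measurableSet_Ioo).mono fun t ht => ?_
    have h2 : 0 < 1 - t := sub_pos.2 ht.2
    have h3 : 0 < t := ht.1
    simp only [Pi.zero_apply]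
    positivity
  have hi : IntegrableOn (fun t : ℝ => 1 / beta a b * t ^ (a - 1) * (1 - t) ^ (b - 1))
      (Ioo 0 1) := by
    refine (lintegral_ofReal_ne_top_iff_integrable hm.aestronglyMeasurable hnn).1 ?_
    rw [h1]
    exact ENNReal.one_ne_top
  have hv : ∫ t in Ioo (0 : ℝ) 1, 1 / beta a b * t ^ (a - 1) * (1 - t) ^ (b - 1) = 1 := by
    rw [integral_eq_lintegral_of_nonneg_ae hnn hm.aestronglyMeasurable, h1, ENNReal.toReal_one]
  have he : (fun t : ℝ => t ^ (a - 1) * (1 - t) ^ (b - 1)) =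
      fun t => beta a b * (1 / beta a b * t ^ (a - 1) * (1 - t) ^ (b - 1)) := by
    funext t
    field_simp
  rw [he]
  refine ⟨hi.const_mul _, ?_⟩
  rw [integral_const_mul, hv, mul_one]

theorem pow_mul_beta_weight_eqOn (a b : ℝ) (k : ℕ) :
    EqOn (fun t : ℝ => t ^ ((a + k) - 1) * (1 - t) ^ (b - 1))
      (fun t => t ^ k * (t ^ (a - 1) * (1 - t) ^ (b - 1))) (Ioo 0 1) := by
  intro t ht
  have h3 : 0 < t := ht.1
  simp only
  rw [show a + k - 1 = (k : ℝ) + (a - 1) by ring, Real.rpow_add h3, Real.rpow_natCast, mul_assoc]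

/-- The moments of the weight `t ^ (a - 1) * (1 - t) ^ (b - 1)` on `[0, 1]`. -/
noncomputable def betaMoment (a b : ℝ) (k : ℕ) : ℝ :=
  ∫ t in Icc (0 : ℝ) 1, t ^ k * (t ^ (a - 1) * (1 - t) ^ (b - 1))

theorem integrableOn_pow_mul_beta_weight {a b : ℝ} (ha : 0 < a) (hb : 0 < b) (k : ℕ) :
    IntegrableOn (fun t : ℝ => t ^ k * (t ^ (a - 1) * (1 - t) ^ (b - 1))) (Icc 0 1) := by
  rw [integrableOn_Icc_iff_integrableOn_Ioo]
  exact (integrableOn_and_integral_beta (by positivity : 0 < a + k) hb).1.congr_fun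
    (pow_mul_beta_weight_eqOn a b k) measurableSet_Ioo

theorem betaMoment_eq {a b : ℝ} (ha : 0 < a) (hb : 0 < b) (k : ℕ) :
    betaMoment a b k = beta (a + k) b := by
  rw [betaMoment, integral_Icc_eq_integral_Ioo,
    ← setIntegral_congr_fun measurableSet_Ioo (pow_mul_beta_weight_eqOn a b k)]
  exact (integrableOn_and_integral_beta (by positivity : 0 < a + k) hb).2

theorem betaMoment_succ {a b : ℝ} (ha : 0 < a) (hb : 0 < b) (k : ℕ) :
    (a + b + k) * betaMoment a b (k + 1) = (a + k) * betaMoment a b k := by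
  rw [betaMoment_eq ha hb, betaMoment_eq ha hb, beta, beta]
  have h1 : a + k ≠ 0 := by positivity
  have h2 : a + k + b ≠ 0 := by positivity
  have h3 : Real.Gamma (a + k + b) ≠ 0 := (Real.Gamma_pos_of_pos (by positivity)).ne'
  push_cast
  rw [← add_assoc, Real.Gamma_add_one h1, show a + k + 1 + b = a + k + b + 1 by ring,
    Real.Gamma_add_one h2]
  field_simp
  ring

end BetaMoments

section JacobiFunctional

open MvPolynomial

/-- The one-particle weight of the Jacobi ensemble, as a function on the cube. -/
noncomputable def jacobiWeight {N : ℕ} (a b : ℝ) (x : Fin N → ℝ) : ℝ :=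
  ∏ i, x i ^ (a - 1) * (1 - x i) ^ (b - 1)

theorem eval_monomial_mul_jacobiWeight {N : ℕ} (a b c : ℝ) (α : Fin N →₀ ℕ) (x : Fin N → ℝ) :
    eval x (monomial α c) * jacobiWeight a b x =
      c * ∏ i, (x i ^ α i * (x i ^ (a - 1) * (1 - x i) ^ (b - 1))) := by
  rw [eval_monomial, Finsupp.prod_fintype _ _ (fun i => pow_zero _), jacobiWeight, mul_assoc,
    ← prod_mul_distrib]

theorem volume_restrict_cube (N : ℕ) :
    (volume : Measure (Fin N → ℝ)).restrict (Set.univ.pi fun _ => Set.Icc 0 1) =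
      Measure.pi fun _ => volume.restrict (Set.Icc 0 1) := by
  rw [volume_pi, Measure.restrict_pi_pi]

theorem integrableOn_eval_mul_jacobiWeight {N : ℕ} {a b : ℝ} (ha : 0 < a) (hb : 0 < b)
    (P : MvPolynomial (Fin N) ℝ) :
    IntegrableOn (fun x => eval x P * jacobiWeight a b x)
      (Set.univ.pi fun _ => Set.Icc (0 : ℝ) 1) := by
  induction P using MvPolynomial.induction_on' with
  | monomial α c =>
    simp only [eval_monomial_mul_jacobiWeight]
    refine Integrable.const_mul ?_ c
    rw [volume_restrict_cube]
    exact Integrable.fintype_prod_dep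
      (f := fun i (t : ℝ) => t ^ α i * (t ^ (a - 1) * (1 - t) ^ (b - 1)))
      fun i => integrableOn_pow_mul_beta_weight ha hb (α i)
  | add P Q hP hQ =>
    simp only [map_add, add_mul]
    exact hP.add hQ

/-- Integration of a polynomial against the product of beta weights on the cube. -/
noncomputable def jacobiFunctional (N : ℕ) {a b : ℝ} (ha : 0 < a) (hb : 0 < b) :
    MvPolynomial (Fin N) ℝ →ₗ[ℝ] ℝ where
  toFun P := ∫ x in Set.univ.pi fun _ => Set.Icc (0 : ℝ) 1, eval x P * jacobiWeight a b x
  map_add' P Q := by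
    simp only [map_add, add_mul]
    exact integral_add (integrableOn_eval_mul_jacobiWeight ha hb P)
      (integrableOn_eval_mul_jacobiWeight ha hb Q)
  map_smul' c P := by
    simp only [smul_eval, mul_assoc, integral_const_mul, RingHom.id_apply, smul_eq_mul]

variable {N : ℕ} {a b : ℝ} (ha : 0 < a) (hb : 0 < b)

theorem jacobiFunctional_apply (P : MvPolynomial (Fin N) ℝ) :
    jacobiFunctional N ha hb P =
      ∫ x in Set.univ.pi fun _ => Set.Icc (0 : ℝ) 1, eval x P * jacobiWeight a b x := rfl

theorem jacobiFunctional_monomial (α : Fin N →₀ ℕ) (c : ℝ) :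
    jacobiFunctional N ha hb (monomial α c) = c * ∏ i, betaMoment a b (α i) := by
  simp only [jacobiFunctional_apply, eval_monomial_mul_jacobiWeight]
  rw [integral_const_mul, volume_restrict_cube]
  congr 1
  exact integral_fintype_prod_eq_prod
    (f := fun i (t : ℝ) => t ^ α i * (t ^ (a - 1) * (1 - t) ^ (b - 1)))

theorem jacobiFunctional_le_of_eval_le (B : ℝ) (P Q : MvPolynomial (Fin N) ℝ)
    (h : ∀ x : Fin N → ℝ, (∀ i, x i ∈ Set.Icc (0 : ℝ) 1) → |eval x P| ≤ B * eval x Q) :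
    |jacobiFunctional N ha hb P| ≤ B * jacobiFunctional N ha hb Q := by
  rw [← smul_eq_mul, ← map_smul, jacobiFunctional_apply, jacobiFunctional_apply,
    ← Real.norm_eq_abs]
  refine norm_integral_le_of_norm_le (integrableOn_eval_mul_jacobiWeight ha hb _) ?_
  refine (ae_restrict_mem (MeasurableSet.univ_pi fun _ => measurableSet_Icc)).mono fun x hx => ?_
  have hx' : ∀ i, x i ∈ Set.Icc (0 : ℝ) 1 := fun i => hx i (Set.mem_univ i)
  have hw : 0 ≤ jacobiWeight a b x := by
    refine prod_nonneg fun i _ => mul_nonneg (Real.rpow_nonneg (hx' i).1 _)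
      (Real.rpow_nonneg (sub_nonneg.2 (hx' i).2) _)
  rw [norm_mul, Real.norm_eq_abs, Real.norm_of_nonneg hw, smul_eval]
  exact mul_le_mul_of_nonneg_right (h x hx') hw

/-- The derivation `∑ i, x_i ^ m ∂_i`. -/
noncomputable def powDerivation (N m : ℕ) :
    Derivation ℝ (MvPolynomial (Fin N) ℝ) (MvPolynomial (Fin N) ℝ) :=
  mkDerivation ℝ fun i => X i ^ m

theorem powDerivation_X (m : ℕ) (i : Fin N) :
    powDerivation N m (X i) = X i ^ m := mkDerivation_X _ _ _

theorem powDerivation_succ_monomial (n : ℕ) (α : Fin N →₀ ℕ) :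
    powDerivation N (n + 1) (monomial α 1) =
      ∑ i, monomial (α + Finsupp.single i n) (α i : ℝ) := by
  rw [powDerivation, mkDerivation_monomial, one_smul,
    Finsupp.sum_fintype _ _ (fun i => by simp)]
  refine sum_congr rfl fun i _ => ?_
  rw [X_pow_eq_monomial, smul_eq_mul, monomial_mul, mul_one]
  by_cases h : α i = 0
  · simp [h]
  · have he : α - Finsupp.single i 1 + Finsupp.single i (n + 1) = α + Finsupp.single i n := by
      ext j
      by_cases hj : j = i
      · subst hj
        simp only [Finsupp.add_apply, Finsupp.tsub_apply, Finsupp.single_eq_same]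
        omega
      · simp [hj]
    rw [he]

theorem psum_mul_monomial (n : ℕ) (α : Fin N →₀ ℕ) :
    psum (Fin N) ℝ n * monomial α 1 = ∑ i, monomial (α + Finsupp.single i n) (1 : ℝ) := by
  rw [psum, sum_mul]
  refine sum_congr rfl fun i _ => ?_
  rw [X_pow_eq_monomial, monomial_mul, mul_one, add_comm]

/-- Integration by parts against the product of beta weights. -/
theorem jacobiFunctional_integration_by_parts (n : ℕ) (P : MvPolynomial (Fin N) ℝ) :
    jacobiFunctional N ha hb (powDerivation N (n + 1) P) -
      jacobiFunctional N ha hb (powDerivation N (n + 2) P) +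
      ((n + a) * jacobiFunctional N ha hb (psum (Fin N) ℝ n * P) -
        (n + a + b) * jacobiFunctional N ha hb (psum (Fin N) ℝ (n + 1) * P)) = 0 := by
  induction P using MvPolynomial.induction_on' with
  | monomial α c =>
    rw [← mul_one c, ← smul_eq_mul, ← smul_monomial]
    simp only [Derivation.map_smul, map_smul, mul_smul_comm, powDerivation_succ_monomial,
      psum_mul_monomial, map_sum, jacobiFunctional_monomial, smul_eq_mul, one_mul]
    have key : ∀ i : Fin N, (α i : ℝ) * ∏ j, betaMoment a b ((α + Finsupp.single i n) j) -
        α i * ∏ j, betaMoment a b ((α + Finsupp.single i (n + 1)) j) +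
        ((n + a) * (1 * ∏ j, betaMoment a b ((α + Finsupp.single i n) j)) -
        (n + a + b) * (1 * ∏ j, betaMoment a b ((α + Finsupp.single i (n + 1)) j))) = 0 := by
      intro i
      have hp : ∀ m : ℕ, ∏ j, betaMoment a b ((α + Finsupp.single i m) j) =
          betaMoment a b (α i + m) * ∏ j ∈ univ.erase i, betaMoment a b (α j) := by
        intro m
        rw [← mul_prod_erase univ _ (mem_univ i)]
        congr 1
        · simp
        · refine prod_congr rfl fun j hj => ?_
          simp [ne_of_mem_erase hj]
      have hr := betaMoment_succ ha hb (α i + n)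
      push_cast at hr
      rw [hp, hp, ← add_assoc]
      linear_combination (-∏ j ∈ univ.erase i, betaMoment a b (α j)) * hr
    have hs := sum_eq_zero (s := univ) fun i _ => key i
    simp only [one_mul, sum_add_distrib, sum_sub_distrib, ← mul_sum] at hs
    linear_combination c * hs
  | add P Q hP hQ =>
    simp only [map_add, mul_add]
    linear_combination hP + hQ

end JacobiFunctional

section LoopEquations

open MvPolynomial

theorem Derivation.map_prod_of_eq_mul {R B ι : Type*} [CommRing R] [CommRing B] [Algebra R B]
    (D : Derivation R B B) (s : Finset ι) (f g : ι → B) (h : ∀ i ∈ s, D (f i) = f i * g i) :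
    D (∏ i ∈ s, f i) = (∏ i ∈ s, f i) * ∑ i ∈ s, g i := by
  classical
  induction s using Finset.induction_on with
  | empty => simp
  | insert i s hi ih =>
    rw [prod_insert hi, sum_insert hi, D.leibniz, ih fun j hj => h j (mem_insert_of_mem hj),
      h i (mem_insert_self i s), smul_eq_mul, smul_eq_mul]
    ring

/-- The square of the Vandermonde determinant. -/
noncomputable def vandermondeSq (N : ℕ) : MvPolynomial (Fin N) ℝ :=
  ∏ i, ∏ j ∈ Ioi i, (X i - X j) ^ 2

theorem powDerivation_vandermondeSq (N n : ℕ) :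
    powDerivation N (n + 1) (vandermondeSq N) = vandermondeSq N *
      (∑ l ∈ range (n + 1), psum (Fin N) ℝ l * psum (Fin N) ℝ (n - l) -
        (n + 1) * psum (Fin N) ℝ n) := by
  set h : Fin N → Fin N → MvPolynomial (Fin N) ℝ :=
    fun i j => ∑ l ∈ range (n + 1), X i ^ l * X j ^ (n - l) with hh
  have hgeom : ∀ i j, h i j * (X i - X j) = X i ^ (n + 1) - X j ^ (n + 1) := fun i j =>
    geom_sum₂_mul (X i) (X j) (n + 1)
  have hpair : ∀ i j : Fin N, powDerivation N (n + 1) ((X i - X j) ^ 2) =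
      (X i - X j) ^ 2 * (h j i + h i j) := by
    intro i j
    rw [Derivation.leibniz_pow, map_sub, powDerivation_X, powDerivation_X]
    simp only [Nat.add_one_sub_one, pow_one, smul_eq_mul, nsmul_eq_mul, Nat.cast_ofNat]
    linear_combination -(X i - X j) * hgeom i j + (X i - X j) * hgeom j i
  have hdiag : ∑ i, h i i = (n + 1) * psum (Fin N) ℝ n := by
    rw [psum, mul_sum]
    refine sum_congr rfl fun i _ => ?_
    have : ∀ l ∈ range (n + 1), (X i : MvPolynomial (Fin N) ℝ) ^ l * X i ^ (n - l) = X i ^ n := by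
      intro l hl
      rw [← pow_add, Nat.add_sub_cancel' (Nat.lt_succ_iff.1 (mem_range.1 hl))]
    rw [hh]
    simp only
    rw [sum_congr rfl this]
    simp
  have hall : ∑ i, ∑ j, h j i =
      ∑ l ∈ range (n + 1), psum (Fin N) ℝ l * psum (Fin N) ℝ (n - l) := by
    simp only [hh, psum, sum_mul_sum]
    rw [sum_comm]
    conv_rhs => rw [sum_comm]
    exact sum_congr rfl fun i _ => sum_comm
  rw [vandermondeSq, Derivation.map_prod_of_eq_mul _ _ _ (fun i => ∑ j ∈ Ioi i, (h j i + h i j))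
    fun i _ => Derivation.map_prod_of_eq_mul _ _ _ _ fun j _ => hpair i j]
  congr 1
  rw [sum_sum_Ioi_add_eq_sum_sum_off_diag, ← hall, ← hdiag, ← sum_sub_distrib]
  refine sum_congr rfl fun i _ => ?_
  rw [← sum_compl_add_sum {i}, sum_singleton, add_sub_cancel_right]

theorem powDerivation_psum (N m k : ℕ) :
    powDerivation N (m + 1) (psum (Fin N) ℝ k) = (k : ℝ) • psum (Fin N) ℝ (k + m) := by
  rw [psum, psum, map_sum, smul_sum]
  refine sum_congr rfl fun i _ => ?_
  rw [Derivation.leibniz_pow, powDerivation_X, Nat.cast_smul_eq_nsmul]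
  cases k with
  | zero => simp
  | succ k =>
    rw [Nat.add_one_sub_one, smul_eq_mul, ← pow_add]
    congr 2
    ring

theorem sum_psum_mul_psum_succ (N n : ℕ) :
    ∑ l ∈ range (n + 1 + 1), psum (Fin N) ℝ l * psum (Fin N) ℝ (n + 1 - l) =
      ∑ l ∈ range n, psum (Fin N) ℝ (l + 1) * psum (Fin N) ℝ (n - l) +
        2 * (N : ℝ) • psum (Fin N) ℝ (n + 1) := by
  rw [sum_range_succ, sum_range_succ', Nat.sub_self, psum_zero, Fintype.card_fin, Nat.sub_zero]
  simp only [Nat.add_sub_add_right]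
  rw [Nat.cast_smul_eq_nsmul, nsmul_eq_mul]
  ring

/-- The product of power sums indexed by a list. -/
noncomputable def psumProd (N : ℕ) (L : List ℕ) : MvPolynomial (Fin N) ℝ :=
  (L.map (psum (Fin N) ℝ)).prod

theorem psumProd_cons (N k : ℕ) (L : List ℕ) :
    psumProd N (k :: L) = psum (Fin N) ℝ k * psumProd N L := by
  simp [psumProd]

theorem abs_eval_psum_le {N : ℕ} {x : Fin N → ℝ} (hx : ∀ i, x i ∈ Set.Icc (0 : ℝ) 1) (k : ℕ) :
    |eval x (psum (Fin N) ℝ k)| ≤ N := by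
  have h : ∀ i, x i ^ k ∈ Set.Icc (0 : ℝ) 1 := fun i =>
    ⟨pow_nonneg (hx i).1 k, pow_le_one₀ (hx i).1 (hx i).2⟩
  rw [psum, map_sum]
  simp only [map_pow, eval_X]
  rw [abs_of_nonneg (sum_nonneg fun i _ => (h i).1)]
  simpa using sum_le_sum (s := univ) fun i _ => (h i).2

theorem abs_eval_psumProd_le {N : ℕ} {x : Fin N → ℝ} (hx : ∀ i, x i ∈ Set.Icc (0 : ℝ) 1)
    (L : List ℕ) : |eval x (psumProd N L)| ≤ (N : ℝ) ^ L.length := by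
  induction L with
  | nil => simp [psumProd]
  | cons k L ih =>
    rw [psumProd_cons, map_mul, abs_mul, List.length_cons, pow_succ']
    exact mul_le_mul (abs_eval_psum_le hx k) ih (abs_nonneg _) (Nat.cast_nonneg N)

theorem abs_eval_powDerivation_psumProd_le {N : ℕ} {x : Fin N → ℝ}
    (hx : ∀ i, x i ∈ Set.Icc (0 : ℝ) 1) (m : ℕ) (L : List ℕ) :
    |eval x (powDerivation N (m + 1) (psumProd N L))| ≤ L.sum * (N : ℝ) ^ L.length := by
  induction L with
  | nil => simp [psumProd]
  | cons k L ih =>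
    rw [psumProd_cons, Derivation.leibniz, powDerivation_psum, smul_eq_mul, smul_eq_mul, map_add,
      map_mul, map_mul, smul_eval, List.length_cons, pow_succ', List.sum_cons]
    refine (abs_add_le _ _).trans ?_
    rw [abs_mul, abs_mul, abs_mul, Nat.abs_cast]
    have h1 := mul_le_mul (abs_eval_psum_le hx k) ih (abs_nonneg _) (Nat.cast_nonneg N)
    have h2 := mul_le_mul (abs_eval_psumProd_le hx L)
      (mul_le_mul_of_nonneg_left (abs_eval_psum_le hx (k + m)) (Nat.cast_nonneg (α := ℝ) k))
      (by positivity) (by positivity)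
    rw [Nat.cast_add]
    linarith

variable {N : ℕ} {a b : ℝ} (ha : 0 < a) (hb : 0 < b)

theorem eval_vandermondeSq (x : Fin N → ℝ) :
    eval x (vandermondeSq N) = ∏ i, ∏ j ∈ Ioi i, (x i - x j) ^ 2 := by
  simp [vandermondeSq, map_prod]

theorem eval_vandermondeSq_nonneg (x : Fin N → ℝ) : 0 ≤ eval x (vandermondeSq N) := by
  rw [eval_vandermondeSq]
  positivity

theorem jacobiFunctional_vandermondeSq_pos : 0 < jacobiFunctional N ha hb (vandermondeSq N) := by
  rw [jacobiFunctional_apply, setIntegral_pos_iff_support_of_nonneg_ae]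
  · set U : Set (Fin N → ℝ) := (Set.univ.pi fun _ => Set.Ioo (0 : ℝ) 1) ∩
      ⋂ i, ⋂ j, ⋂ _ : i ≠ j, {x | x i ≠ x j} with hU
    have hopen : IsOpen U := by
      refine (isOpen_set_pi Set.finite_univ fun _ _ => isOpen_Ioo).inter ?_
      exact isOpen_iInter_of_finite fun i => isOpen_iInter_of_finite fun j =>
        isOpen_iInter_of_finite fun _ => isOpen_ne_fun (continuous_apply i) (continuous_apply j)
    have hmem : ∀ x : Fin N → ℝ, x ∈ U ↔
        (∀ i, x i ∈ Set.Ioo (0 : ℝ) 1) ∧ ∀ i j, i ≠ j → x i ≠ x j := by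
      intro x
      simp only [hU, Set.mem_inter_iff, Set.mem_univ_pi, Set.mem_iInter, Set.mem_ofPred_eq]
    have hne : U.Nonempty := by
      refine ⟨fun i => ((i : ℕ) + 1 : ℝ) / (N + 1),
        (hmem _).2 ⟨fun i => ⟨by positivity, ?_⟩, ?_⟩⟩
      · rw [div_lt_one (by positivity)]
        have : ((i : ℕ) : ℝ) < N := by exact_mod_cast i.2
        linarith
      · intro i j hij h
        have hN : (N : ℝ) + 1 ≠ 0 := by positivity
        rw [div_left_inj' hN, add_left_inj, Nat.cast_inj] at h
        exact hij (Fin.ext h)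
    refine (hopen.measure_pos volume hne).trans_le (measure_mono fun x hxU => ?_)
    have hx := (hmem x).1 hxU
    refine ⟨?_, fun i _ => Set.Ioo_subset_Icc_self (hx.1 i)⟩
    rw [Function.mem_support, eval_vandermondeSq]
    exact mul_ne_zero (prod_ne_zero_iff.2 fun i _ => prod_ne_zero_iff.2 fun j hj =>
      pow_ne_zero 2 (sub_ne_zero.2 (hx.2 i j (mem_Ioi.1 hj).ne)))
      (prod_ne_zero_iff.2 fun i _ => mul_ne_zero (Real.rpow_pos_of_pos (hx.1 i).1 _).ne'
        (Real.rpow_pos_of_pos (sub_pos.2 (hx.1 i).2) _).ne')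
  · refine (ae_restrict_mem (MeasurableSet.univ_pi fun _ => measurableSet_Icc)).mono fun x hx => ?_
    exact mul_nonneg (eval_vandermondeSq_nonneg x) (prod_nonneg fun i _ =>
      mul_nonneg (Real.rpow_nonneg (hx i (Set.mem_univ i)).1 _)
        (Real.rpow_nonneg (sub_nonneg.2 (hx i (Set.mem_univ i)).2) _))
  · exact integrableOn_eval_mul_jacobiWeight ha hb _

/-- The loop equation of the Jacobi ensemble. -/
theorem jacobiFunctional_loop_equation (n : ℕ) (P : MvPolynomial (Fin N) ℝ) :
    (a + b - 2 + 2 * N) *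
        jacobiFunctional N ha hb (vandermondeSq N * (psum (Fin N) ℝ (n + 1) * P)) =
      ∑ l ∈ range (n + 1), jacobiFunctional N ha hb
        (vandermondeSq N * (psum (Fin N) ℝ l * (psum (Fin N) ℝ (n - l) * P))) -
      ∑ l ∈ range n, jacobiFunctional N ha hb
        (vandermondeSq N * (psum (Fin N) ℝ (l + 1) * (psum (Fin N) ℝ (n - l) * P))) +
      (a - 1) * jacobiFunctional N ha hb (vandermondeSq N * (psum (Fin N) ℝ n * P)) +
      jacobiFunctional N ha hb (vandermondeSq N *
        (powDerivation N (n + 1) P - powDerivation N (n + 2) P)) := by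
  have h := jacobiFunctional_integration_by_parts ha hb n (vandermondeSq N * P)
  have hpoly : powDerivation N (n + 1) (vandermondeSq N * P) -
      powDerivation N (n + 2) (vandermondeSq N * P) =
      ∑ l ∈ range (n + 1), vandermondeSq N * (psum (Fin N) ℝ l * (psum (Fin N) ℝ (n - l) * P)) -
      ∑ l ∈ range n,
        vandermondeSq N * (psum (Fin N) ℝ (l + 1) * (psum (Fin N) ℝ (n - l) * P)) -
      ((n : ℝ) + 1) • (vandermondeSq N * (psum (Fin N) ℝ n * P)) +
      ((n : ℝ) + 2 - 2 * N) • (vandermondeSq N * (psum (Fin N) ℝ (n + 1) * P)) +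
      vandermondeSq N * (powDerivation N (n + 1) P - powDerivation N (n + 2) P) := by
    have e1 : ∀ (s : Finset ℕ) (f g : ℕ → MvPolynomial (Fin N) ℝ),
        ∑ l ∈ s, vandermondeSq N * (f l * (g l * P)) =
          vandermondeSq N * P * ∑ l ∈ s, f l * g l := by
      intro s f g
      rw [mul_sum]
      exact sum_congr rfl fun l _ => by ring
    rw [e1, e1, Derivation.leibniz, Derivation.leibniz, powDerivation_vandermondeSq,
      powDerivation_vandermondeSq, sum_psum_mul_psum_succ]
    simp only [smul_eq_mul, smul_eq_C_mul, map_add, map_sub, map_mul, map_natCast, map_one,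
      map_ofNat]
    push_cast
    ring
  have h2 := congrArg (jacobiFunctional N ha hb) hpoly
  simp only [map_sub, map_add, map_sum, map_smul, smul_eq_mul] at h2 ⊢
  rw [mul_left_comm, mul_left_comm (psum (Fin N) ℝ (n + 1))] at h
  linarith

/-- The normalized mixed moment of power sums in the Jacobi ensemble. -/
noncomputable def mixedMoment (N : ℕ) (a b : ℝ) (L : List ℕ) : ℝ :=
  (∫ x in Set.univ.pi fun _ => Set.Icc (0 : ℝ) 1,
      eval x (vandermondeSq N * psumProd N L) * jacobiWeight a b x) /
    (∫ x in Set.univ.pi fun _ => Set.Icc (0 : ℝ) 1,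
      eval x (vandermondeSq N) * jacobiWeight a b x) / (N : ℝ) ^ L.length

theorem mixedMoment_eq (L : List ℕ) : mixedMoment N a b L =
    jacobiFunctional N ha hb (vandermondeSq N * psumProd N L) /
      jacobiFunctional N ha hb (vandermondeSq N) / (N : ℝ) ^ L.length := rfl

end LoopEquations

theorem mixedMoment_nil {N : ℕ} {a b : ℝ} (ha : 0 < a) (hb : 0 < b) :
    mixedMoment N a b [] = 1 := by
  rw [mixedMoment_eq ha hb]
  simp [psumProd, (jacobiFunctional_vandermondeSq_pos (N := N) ha hb).ne']

theorem mixedMoment_zero_cons {N : ℕ} {a b : ℝ} (ha : 0 < a) (hb : 0 < b) (hN : 1 ≤ N)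
    (L : List ℕ) :
    mixedMoment N a b (0 :: L) = mixedMoment N a b L := by
  have hN' : (N : ℝ) ≠ 0 := by positivity
  have h : vandermondeSq N * psumProd N (0 :: L) =
      (N : ℝ) • (vandermondeSq N * psumProd N L) := by
    rw [psumProd_cons, MvPolynomial.psum_zero, Fintype.card_fin, Nat.cast_smul_eq_nsmul, nsmul_eq_mul]
    ring
  rw [mixedMoment_eq ha hb, mixedMoment_eq ha hb, h, map_smul, smul_eq_mul, List.length_cons,
    pow_succ']
  field_simp

theorem abs_mixedMoment_loop_remainder_le {N : ℕ} {a b : ℝ} (ha : 0 < a) (hb : 0 < b)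
    (hN : 1 ≤ N) (n : ℕ) (L : List ℕ) :
    |(a + b - 2 + 2 * N) / N * mixedMoment N a b ((n + 1) :: L) -
      (∑ l ∈ range (n + 1), mixedMoment N a b (l :: (n - l) :: L) -
        ∑ l ∈ range n, mixedMoment N a b ((l + 1) :: (n - l) :: L) +
        (a - 1) / N * mixedMoment N a b (n :: L))| ≤ 2 * L.sum / (N : ℝ) ^ 2 := by
  have hN' : (0 : ℝ) < N := by positivity
  have hZ := jacobiFunctional_vandermondeSq_pos (N := N) ha hb
  have hloop := jacobiFunctional_loop_equation ha hb n (psumProd N L)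
  have hR := jacobiFunctional_le_of_eval_le ha hb (2 * L.sum * (N : ℝ) ^ L.length)
    (vandermondeSq N * (powDerivation N (n + 1) (psumProd N L) -
      powDerivation N (n + 2) (psumProd N L))) (vandermondeSq N) fun x hx => by
    rw [map_mul, map_sub, abs_mul, abs_of_nonneg (eval_vandermondeSq_nonneg x), mul_comm]
    refine mul_le_mul_of_nonneg_right ?_ (eval_vandermondeSq_nonneg x)
    have h1 := abs_eval_powDerivation_psumProd_le hx n L
    have h2 := abs_eval_powDerivation_psumProd_le hx (n + 1) L
    refine (abs_sub _ _).trans ?_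
    linarith
  simp only [← psumProd_cons] at hloop
  simp only [mixedMoment_eq ha hb, List.length_cons, ← sum_div]
  set Z := jacobiFunctional N ha hb (vandermondeSq N)
  set R := jacobiFunctional N ha hb (vandermondeSq N * (powDerivation N (n + 1) (psumProd N L) -
      powDerivation N (n + 2) (psumProd N L)))
  have heq : ∀ w s₁ s₂ w' : ℝ, (a + b - 2 + 2 * N) * w = s₁ - s₂ + (a - 1) * w' + R →
      (a + b - 2 + 2 * N) / N * (w / Z / (N : ℝ) ^ (L.length + 1)) -
        (s₁ / Z / (N : ℝ) ^ (L.length + 1 + 1) - s₂ / Z / (N : ℝ) ^ (L.length + 1 + 1) +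
          (a - 1) / N * (w' / Z / (N : ℝ) ^ (L.length + 1))) =
      R / (Z * (N : ℝ) ^ (L.length + 2)) := by
    intro w s₁ s₂ w' h
    have hR' : R = (a + b - 2 + 2 * N) * w - (s₁ - s₂ + (a - 1) * w') := by linarith
    rw [hR']
    field_simp
    ring
  rw [heq _ _ _ _ hloop, abs_div, abs_of_pos (by positivity : 0 < Z * (N : ℝ) ^ (L.length + 2)),
    div_le_div_iff₀ (by positivity) (by positivity)]
  calc |R| * (N : ℝ) ^ 2 ≤ (2 * L.sum * (N : ℝ) ^ L.length * Z) * (N : ℝ) ^ 2 := by gcongr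
    _ = _ := by ring

theorem tendsto_affine_div_natCast (c d : ℝ) :
    Filter.Tendsto (fun N : ℕ => (c * N + d) / (N : ℝ)) Filter.atTop (nhds c) := by
  have h := (tendsto_const_div_atTop_nhds_zero_nat d).const_add c
  rw [add_zero] at h
  refine h.congr' ?_
  filter_upwards [Filter.eventually_ge_atTop 1] with N hN
  have hN' : (N : ℝ) ≠ 0 := by positivity
  field_simp

theorem slope_nonneg_of_affine_pos {c d : ℝ} (h : ∀ N : ℕ, 1 ≤ N → 0 < c * (N : ℝ) + d) :
    0 ≤ c := by
  refine ge_of_tendsto (tendsto_affine_div_natCast c d) ?_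
  filter_upwards [Filter.eventually_ge_atTop 1] with N hN
  exact div_nonneg (h N hN).le (Nat.cast_nonneg N)

theorem tendsto_mixedMoment {a₁ a₀ b₁ b₀ : ℝ}
    (ha : ∀ N : ℕ, 1 ≤ N → 0 < a₁ * (N : ℝ) + a₀)
    (hb : ∀ N : ℕ, 1 ≤ N → 0 < b₁ * (N : ℝ) + b₀) (L : List ℕ) :
    Filter.Tendsto (fun N : ℕ => mixedMoment N (a₁ * (N : ℝ) + a₀) (b₁ * (N : ℝ) + b₀) L)
      Filter.atTop (nhds (L.map (limitMoment (1 + a₁) (2 + a₁ + b₁))).prod) := by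
  have ha₁ := slope_nonneg_of_affine_pos ha
  have hb₁ := slope_nonneg_of_affine_pos hb
  have hA : 1 + a₁ ≠ 0 := by positivity
  have hs : 2 + a₁ + b₁ ≠ 0 := by positivity
  set c := limitMoment (1 + a₁) (2 + a₁ + b₁) with hc
  induction hw : 2 * (L.map fun k => k ^ 2).sum + L.length using Nat.strong_induction_on
    generalizing L with
  | _ w ih =>
  match L with
  | [] =>
    refine tendsto_const_nhds.congr' ?_
    filter_upwards [Filter.eventually_ge_atTop 1] with N hN
    simp [mixedMoment_nil (ha N hN) (hb N hN)]
  | 0 :: L =>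
    have h := ih _ (by rw [← hw]; simp) L rfl
    rw [List.map_cons, List.prod_cons, hc, limitMoment_zero, one_mul, ← hc]
    refine h.congr' ?_
    filter_upwards [Filter.eventually_ge_atTop 1] with N hN
    rw [mixedMoment_zero_cons (ha N hN) (hb N hN) hN]
  | (n + 1) :: L =>
    simp only [List.map_cons, List.sum_cons, List.length_cons] at hw
    have h₁ : ∀ l ∈ range (n + 1), Filter.Tendsto
        (fun N : ℕ => mixedMoment N (a₁ * (N : ℝ) + a₀) (b₁ * (N : ℝ) + b₀) (l :: (n - l) :: L))
        Filter.atTop (nhds (c l * c (n - l) * (L.map c).prod)) := by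
      intro l hl
      obtain ⟨m, rfl⟩ := Nat.exists_eq_add_of_le (Nat.lt_succ_iff.1 (mem_range.1 hl))
      have h := ih _ (by
        simp only [List.map_cons, List.sum_cons, List.length_cons, Nat.add_sub_cancel_left]
        rw [← hw]
        nlinarith [Nat.zero_le (l * m)]) (l :: (l + m - l) :: L) rfl
      simpa only [List.map_cons, List.prod_cons, mul_assoc] using h
    have h₂ : ∀ l ∈ range n, Filter.Tendsto
        (fun N : ℕ => mixedMoment N (a₁ * (N : ℝ) + a₀) (b₁ * (N : ℝ) + b₀)
          ((l + 1) :: (n - l) :: L))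
        Filter.atTop (nhds (c (l + 1) * c (n - l) * (L.map c).prod)) := by
      intro l hl
      obtain ⟨m, rfl⟩ := Nat.exists_eq_add_of_lt (mem_range.1 hl)
      have h := ih _ (by
        simp only [List.map_cons, List.sum_cons, List.length_cons, add_assoc,
          Nat.add_sub_cancel_left]
        rw [← hw]
        nlinarith [Nat.zero_le (l * m)]) ((l + 1) :: (l + m + 1 - l) :: L) rfl
      simpa only [List.map_cons, List.prod_cons, mul_assoc] using h
    have h₃ := ih _ (by
      simp only [List.map_cons, List.sum_cons, List.length_cons]
      have hlt : n ^ 2 < (n + 1) ^ 2 := Nat.pow_lt_pow_left (Nat.lt_succ_self n) two_ne_zero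
      omega) (n :: L) rfl
    rw [List.map_cons, List.prod_cons] at h₃ ⊢
    have ha' : Filter.Tendsto (fun N : ℕ => (a₁ * (N : ℝ) + a₀ - 1) / N) Filter.atTop
        (nhds a₁) := by
      simpa only [add_sub_assoc] using tendsto_affine_div_natCast a₁ (a₀ - 1)
    have hs' : Filter.Tendsto (fun N : ℕ =>
        (a₁ * (N : ℝ) + a₀ + (b₁ * (N : ℝ) + b₀) - 2 + 2 * N) / N) Filter.atTop
        (nhds (2 + a₁ + b₁)) := by
      refine (tendsto_affine_div_natCast (2 + a₁ + b₁) (a₀ + b₀ - 2)).congr fun N => ?_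
      ring
    have hmain := ((tendsto_finsetSum _ h₁).sub (tendsto_finsetSum _ h₂)).add (ha'.mul h₃)
    have hbound : Filter.Tendsto (fun N : ℕ => 2 * (L.sum : ℝ) / (N : ℝ) ^ 2) Filter.atTop
        (nhds 0) :=
      tendsto_const_nhds.div_atTop
        ((Filter.tendsto_pow_atTop two_ne_zero).comp tendsto_natCast_atTop_atTop)
    have hrem : Filter.Tendsto (fun N : ℕ =>
        (a₁ * (N : ℝ) + a₀ + (b₁ * (N : ℝ) + b₀) - 2 + 2 * N) / N *
          mixedMoment N (a₁ * (N : ℝ) + a₀) (b₁ * (N : ℝ) + b₀) ((n + 1) :: L) -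
        (∑ l ∈ range (n + 1),
            mixedMoment N (a₁ * (N : ℝ) + a₀) (b₁ * (N : ℝ) + b₀) (l :: (n - l) :: L) -
          ∑ l ∈ range n,
            mixedMoment N (a₁ * (N : ℝ) + a₀) (b₁ * (N : ℝ) + b₀) ((l + 1) :: (n - l) :: L) +
          (a₁ * (N : ℝ) + a₀ - 1) / N *
            mixedMoment N (a₁ * (N : ℝ) + a₀) (b₁ * (N : ℝ) + b₀) (n :: L)))
        Filter.atTop (nhds 0) := squeeze_zero_norm' (Filter.eventually_atTop.2 ⟨1, fun N hN =>
      abs_mixedMoment_loop_remainder_le (ha N hN) (hb N hN) hN n L⟩) hbound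
    have hfinal := (hrem.add hmain).div hs' hs
    have hlim : (0 + (∑ l ∈ range (n + 1), c l * c (n - l) * (L.map c).prod -
        ∑ l ∈ range n, c (l + 1) * c (n - l) * (L.map c).prod +
        a₁ * (c n * (L.map c).prod))) / (2 + a₁ + b₁) = c (n + 1) * (L.map c).prod := by
      have hrec := mul_limitMoment_succ hA hs n
      rw [← hc, add_sub_cancel_left] at hrec
      rw [div_eq_iff hs, ← sum_mul, ← sum_mul]
      linear_combination (-(L.map c).prod) * hrec
    rw [hlim] at hfinal
    refine hfinal.congr' ?_
    filter_upwards [hs'.eventually_ne hs] with N hN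
    simp only [Pi.div_apply]
    rw [sub_add_cancel, mul_div_cancel_left₀ _ hN]

theorem Ik_div_eq_mixedMoment (k N : ℕ) (a b : ℝ) :
    Ik k N a b / N = mixedMoment N a b [k] := by
  have hf : (((N.factorial : ℕ) : ℝ))⁻¹ ≠ 0 := by positivity
  rw [Ik, jacobiAvg, jacobiAvg, mul_div_mul_left _ _ hf, mixedMoment]
  simp only [List.length_singleton, pow_one, one_mul, map_mul, eval_vandermondeSq, jacobiWeight,
    psumProd, List.map_singleton, List.prod_singleton, MvPolynomial.psum, map_sum, map_pow,
    MvPolynomial.eval_X]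
  congr 3
  funext x
  ring

theorem Ik_div_N_limit (k : ℕ) (hk : 1 ≤ k) (a₁ a₀ b₁ b₀ : ℝ)
    (ha : ∀ N : ℕ, 1 ≤ N → 0 < a₁ * (N : ℝ) + a₀)
    (hb : ∀ N : ℕ, 1 ≤ N → 0 < b₁ * (N : ℝ) + b₀) :
    Filter.Tendsto
      (fun N : ℕ => Ik k N (a₁ * (N : ℝ) + a₀) (b₁ * (N : ℝ) + b₀) / (N : ℝ))
      Filter.atTop
      (nhds ((1 + a₁) / ((k : ℝ) * (2 + a₁ + b₁) ^ k) *
        ∑ j ∈ Finset.range k,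
          (-1 : ℝ) ^ j * ((1 + a₁) / (2 + a₁ + b₁)) ^ j * ((j + k - 1).choose j : ℝ) *
            ∑ i ∈ Finset.range (k - j),
              (1 + a₁) ^ i * (k.choose (i + j + 1) : ℝ) * (k.choose i : ℝ))) := by
  have ha₁ := slope_nonneg_of_affine_pos ha
  have hb₁ := slope_nonneg_of_affine_pos hb
  have h := tendsto_mixedMoment ha hb [k]
  rw [List.map_singleton, List.prod_singleton,
    limitMoment_eq (by positivity) (by positivity) hk] at h
  simpa only [Ik_div_eq_mixedMoment] using h
end

section
/- Let k ≥ 1 be a natural number and let a_1, a_0, b_0 be real numbers with a_1 ≠ −1. Setting a(N) := a_1·N + a_0 and b(N) := −N + b_0, the sequence N ↦ R_k(N; a(N), b(N))/N converges to 1 as N → ∞. -/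
open Finset

/-- The explicit rational expression `R_k(N;a,b)` from Corollary 2.3
(division by zero is interpreted by the convention `x/0 = 0`). -/
noncomputable def Rk (k N : ℕ) (a b : ℝ) : ℝ :=
  ((k.factorial : ℝ))⁻¹ *
    ∑ i ∈ Finset.range k, (-1 : ℝ) ^ i * ((k - 1).choose i : ℝ) *
      ∏ m ∈ Finset.range k,
        (((N : ℝ) + ((m : ℝ) - (i : ℝ))) * (a + (N : ℝ) + ((m : ℝ) - (i : ℝ)) - 1)) /
          (a + b + 2 * (N : ℝ) + ((m : ℝ) - (i : ℝ)) - 2)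

/-- `HasScaledJet n F p`: for every `j ≤ n`, the rescaled `j`-th forward differences
`N ^ j * Δ^j (F N)` converge pointwise to the `j`-th derivative of `p` at `1`. Heuristically,
`F N s ≈ p (1 + s / N)` to order `n`. -/
def HasScaledJet : ℕ → (ℕ → ℤ → ℝ) → Polynomial ℝ → Prop
  | 0, F, p => ∀ s, Filter.Tendsto (fun N => F N s) Filter.atTop (nhds (p.eval 1))
  | n + 1, F, p => (∀ s, Filter.Tendsto (fun N => F N s) Filter.atTop (nhds (p.eval 1))) ∧
      HasScaledJet n (fun N => (N : ℝ) • fwdDiff 1 (F N)) (Polynomial.derivative p)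

namespace HasScaledJet

variable {n : ℕ} {F G : ℕ → ℤ → ℝ} {p q : Polynomial ℝ}

theorem of_succ (h : HasScaledJet (n + 1) F p) : HasScaledJet n F p := by
  induction n generalizing F p with
  | zero => exact h.1
  | succ n ih => exact ⟨h.1, ih h.2⟩

theorem congr (h : HasScaledJet n F p) (hFG : ∀ s, ∀ᶠ N in Filter.atTop, F N s = G N s) :
    HasScaledJet n G p := by
  induction n generalizing F G p with
  | zero => exact fun s => (h s).congr' (hFG s)
  | succ n ih =>
    refine ⟨fun s => (h.1 s).congr' (hFG s), ih h.2 fun s => ?_⟩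
    filter_upwards [hFG s, hFG (s + 1)] with N h₀ h₁
    simp [fwdDiff, h₀, h₁]

theorem shift (h : HasScaledJet n F p) (t : ℤ) : HasScaledJet n (fun N s => F N (s + t)) p := by
  induction n generalizing F p with
  | zero => exact fun s => h (s + t)
  | succ n ih =>
    refine ⟨fun s => h.1 (s + t), (ih h.2).congr fun s => .of_forall fun N => ?_⟩
    simp [fwdDiff, add_right_comm]

theorem add (hF : HasScaledJet n F p) (hG : HasScaledJet n G q) :
    HasScaledJet n (F + G) (p + q) := by
  induction n generalizing F G p q with
  | zero => exact fun s => by simpa using (hF s).add (hG s)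
  | succ n ih =>
    refine ⟨fun s => by simpa using (hF.1 s).add (hG.1 s), ?_⟩
    rw [Polynomial.derivative_add]
    refine (ih hF.2 hG.2).congr fun s => .of_forall fun N => ?_
    simp [fwdDiff]
    ring

theorem mul (hF : HasScaledJet n F p) (hG : HasScaledJet n G q) :
    HasScaledJet n (F * G) (p * q) := by
  induction n generalizing F G p q with
  | zero => exact fun s => by simpa using (hF s).mul (hG s)
  | succ n ih =>
    refine ⟨fun s => by simpa using (hF.1 s).mul (hG.1 s), ?_⟩
    rw [Polynomial.derivative_mul]
    refine ((ih hF.2 (hG.of_succ.shift 1)).add (ih hF.of_succ hG.2)).congr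
      fun s => .of_forall fun N => ?_
    simp [fwdDiff]
    ring

theorem const (n : ℕ) (c : ℝ) : HasScaledJet n (fun _ _ => c) (Polynomial.C c) := by
  induction n generalizing c with
  | zero => exact fun s => by simp
  | succ n ih =>
    refine ⟨fun s => by simp, ?_⟩
    rw [Polynomial.derivative_C, ← Polynomial.C_0]
    refine (ih 0).congr fun s => .of_forall fun N => ?_
    simp

theorem prod_shift (h : HasScaledJet n F p) (k : ℕ) :
    HasScaledJet n (fun N s => ∏ m ∈ range k, F N (s + m)) (p ^ k) := by
  induction k with
  | zero => simpa using const n 1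
  | succ k ih =>
    rw [pow_succ]
    refine (ih.mul (h.shift k)).congr fun s => .of_forall fun N => ?_
    simp [prod_range_succ]

theorem tendsto_iterate_fwdDiff (h : HasScaledJet n F p) (s : ℤ) :
    Filter.Tendsto (fun N : ℕ => (N : ℝ) ^ n * (fwdDiff 1)^[n] (F N) s) Filter.atTop
      (nhds ((Polynomial.derivative^[n] p).eval 1)) := by
  induction n generalizing F p with
  | zero => simpa using h s
  | succ n ih =>
    refine (ih h.2).congr fun N => ?_
    rw [fwdDiff_iter_const_smul, Function.iterate_succ_apply, Pi.smul_apply, smul_eq_mul]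
    ring

end HasScaledJet

theorem tendsto_abs_mul_natCast_add_atTop {c : ℝ} (hc : c ≠ 0) (e : ℝ) :
    Filter.Tendsto (fun N : ℕ => |c * N + e|) Filter.atTop Filter.atTop := by
  rcases hc.lt_or_gt with h | h
  · exact Filter.tendsto_abs_atBot_atTop.comp <| Filter.tendsto_atBot_add_const_right _ _ <|
      tendsto_natCast_atTop_atTop.const_mul_atTop_of_neg h
  · exact Filter.tendsto_abs_atTop_atTop.comp <| Filter.tendsto_atTop_add_const_right _ _ <|
      tendsto_natCast_atTop_atTop.const_mul_atTop h

theorem eventually_mul_natCast_add_ne_zero {c : ℝ} (hc : c ≠ 0) (e : ℝ) :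
    ∀ᶠ N : ℕ in Filter.atTop, c * N + e ≠ 0 := by
  filter_upwards [(tendsto_abs_mul_natCast_add_atTop hc e).eventually_gt_atTop 0] with N hN
  exact abs_pos.mp hN

theorem tendsto_inv_mul_natCast_add {c : ℝ} (hc : c ≠ 0) (e : ℝ) :
    Filter.Tendsto (fun N : ℕ => (c * N + e)⁻¹) Filter.atTop (nhds 0) := by
  refine (tendsto_zero_iff_abs_tendsto_zero _).2 ?_
  refine (tendsto_abs_mul_natCast_add_atTop hc e).inv_tendsto_atTop.congr fun N => ?_
  simp [abs_inv]

theorem tendsto_natCast_mul_inv {c : ℝ} (hc : c ≠ 0) (e : ℝ) :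
    Filter.Tendsto (fun N : ℕ => (N : ℝ) * (c * N + e)⁻¹) Filter.atTop (nhds c⁻¹) := by
  have h := ((tendsto_inv_mul_natCast_add hc e).const_mul e).const_sub 1 |>.const_mul c⁻¹
  simp only [mul_zero, sub_zero, mul_one] at h
  refine h.congr' ?_
  filter_upwards [eventually_mul_natCast_add_ne_zero hc e] with N hN
  field_simp
  ring

theorem tendsto_pow_mul_inv_prod {c : ℝ} (hc : c ≠ 0) (j : ℕ) (e : ℕ → ℝ) :
    Filter.Tendsto (fun N : ℕ => (N : ℝ) ^ j * (∏ i ∈ range (j + 1), (c * N + e i))⁻¹)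
      Filter.atTop (nhds 0) := by
  have h := (tendsto_finsetProd (range j)
    fun i _ => tendsto_natCast_mul_inv hc (e i)).mul (tendsto_inv_mul_natCast_add hc (e j))
  rw [mul_zero] at h
  refine h.congr fun N => ?_
  rw [prod_mul_distrib, prod_const, card_range, prod_range_succ, mul_inv, prod_inv_distrib,
    mul_assoc]

theorem hasScaledJet_pow_mul_inv_prod {c : ℝ} (hc : c ≠ 0) (e : ℝ) (n j : ℕ) (K : ℝ) :
    HasScaledJet n (fun N s => K *
      ((N : ℝ) ^ j * (∏ i ∈ range (j + 1), (c * N + (e + s + (i : ℝ))))⁻¹)) 0 := by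
  have key (j : ℕ) (K : ℝ) (s : ℤ) : Filter.Tendsto (fun N : ℕ => K *
      ((N : ℝ) ^ j * (∏ i ∈ range (j + 1), (c * N + (e + s + (i : ℝ))))⁻¹))
      Filter.atTop (nhds ((0 : Polynomial ℝ).eval 1)) := by
    simpa using (tendsto_pow_mul_inv_prod hc j fun i => e + s + i).const_mul K
  induction n generalizing j K with
  | zero => exact key j K
  | succ n ih =>
    refine ⟨key j K, ?_⟩
    rw [Polynomial.derivative_zero]
    refine (ih (j + 1) (-(j + 1) * K)).congr fun s => ?_
    have hne : ∀ᶠ N : ℕ in Filter.atTop, ∀ i ∈ range (j + 2), c * N + (e + s + (i : ℝ)) ≠ 0 :=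
      (Filter.eventually_all_finset _).2 fun i _ => eventually_mul_natCast_add_ne_zero hc _
    filter_upwards [hne] with N hN
    have hprod := prod_ne_zero_iff.2 hN
    have h₁ := prod_range_succ (fun i : ℕ => c * N + (e + s + (i : ℝ))) (j + 1)
    have h₂ := prod_range_succ' (fun i : ℕ => c * N + (e + s + (i : ℝ))) (j + 1)
    have h₃ : ∏ i ∈ range (j + 1), (c * N + (e + (s + 1 : ℤ) + (i : ℝ))) =
        ∏ i ∈ range (j + 1), (c * N + (e + s + ((i + 1 : ℕ) : ℝ))) :=
      prod_congr rfl fun i _ => by push_cast; ring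
    simp only [Pi.smul_apply, fwdDiff, smul_eq_mul, h₃]
    rw [show j + 1 + 1 = j + 2 from rfl] at h₁ h₂ ⊢
    generalize ∏ i ∈ range (j + 2), (c * N + (e + s + (i : ℝ))) = P at *
    generalize ∏ i ∈ range (j + 1), (c * N + (e + s + (i : ℝ))) = Q at *
    generalize ∏ i ∈ range (j + 1), (c * N + (e + s + ((i + 1 : ℕ) : ℝ))) = R at *
    have hQ : Q⁻¹ = (c * N + (e + s + ((j + 1 : ℕ) : ℝ))) * P⁻¹ := by
      rw [h₁] at hprod ⊢
      rw [mul_inv, mul_left_comm, mul_inv_cancel₀ (right_ne_zero_of_mul hprod), mul_one]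
    have hR : R⁻¹ = (c * N + (e + s + ((0 : ℕ) : ℝ))) * P⁻¹ := by
      rw [h₂] at hprod ⊢
      rw [mul_inv, mul_left_comm, mul_inv_cancel₀ (right_ne_zero_of_mul hprod), mul_one]
    rw [hQ, hR]
    push_cast
    ring

theorem hasScaledJet_add_div_self (n : ℕ) :
    HasScaledJet n (fun N s => ((N : ℝ) + s) / N) Polynomial.X := by
  have key (s : ℤ) : Filter.Tendsto (fun N : ℕ => ((N : ℝ) + s) / N) Filter.atTop
      (nhds ((Polynomial.X : Polynomial ℝ).eval 1)) := by
    have h := (tendsto_const_div_atTop_nhds_zero_nat (s : ℝ)).const_add 1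
    rw [add_zero] at h
    rw [Polynomial.eval_X]
    refine h.congr' ?_
    filter_upwards [Filter.eventually_ne_atTop 0] with N hN
    field_simp
  cases n with
  | zero => exact key
  | succ n =>
    refine ⟨key, ?_⟩
    rw [Polynomial.derivative_X, ← Polynomial.C_1]
    refine (HasScaledJet.const n 1).congr fun s => ?_
    filter_upwards [Filter.eventually_ne_atTop 0] with N hN
    simp only [Pi.smul_apply, fwdDiff, smul_eq_mul]
    push_cast
    field_simp
    ring

theorem hasScaledJet_factor {c : ℝ} (hc : c ≠ 0) (e d : ℝ) (n : ℕ) :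
    HasScaledJet n (fun N s => ((N : ℝ) + s) * (c * N + (d + s)) / (c * N + (e + s)) / N)
      Polynomial.X := by
  have h := (hasScaledJet_add_div_self n).mul
    ((HasScaledJet.const n 1).add (hasScaledJet_pow_mul_inv_prod hc e n 0 (d - e)))
  rw [Polynomial.C_1, add_zero, mul_one] at h
  refine h.congr fun s => ?_
  filter_upwards [eventually_mul_natCast_add_ne_zero hc (e + s), Filter.eventually_ne_atTop 0]
    with N hN hN₀
  simp only [Pi.mul_apply, Pi.add_apply, zero_add, pow_zero, range_one, prod_singleton,
    Nat.cast_zero, add_zero]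
  rw [show c * N + (d + s) = c * N + (e + s) + (d - e) by ring]
  generalize c * N + (e + s) = D at hN ⊢
  field_simp

theorem iterate_fwdDiff_neg_eq_sum (f : ℤ → ℝ) (n : ℕ) :
    (fwdDiff 1)^[n] f (-n) = ∑ i ∈ range (n + 1), (-1 : ℝ) ^ i * (n.choose i : ℝ) * f (-i) := by
  rw [fwdDiff_iter_eq_sum_shift, ← sum_range_reflect]
  refine sum_congr rfl fun i hi => ?_
  have hi : i ≤ n := Nat.lt_succ_iff.1 (mem_range.1 hi)
  rw [show n + 1 - 1 - i = n - i by omega, Nat.sub_sub_self hi, Nat.choose_symm hi]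
  have : -(n : ℤ) + (n - i) • (1 : ℤ) = -i := by
    rw [nsmul_eq_mul, Nat.cast_sub hi]
    ring
  rw [this]
  simp

theorem Rk_div_N_tendsto_one (k : ℕ) (hk : 1 ≤ k) (a₁ a₀ b₀ : ℝ) (ha₁ : a₁ ≠ -1) :
    Filter.Tendsto
      (fun N : ℕ => Rk k N (a₁ * (N : ℝ) + a₀) (-(N : ℝ) + b₀) / (N : ℝ))
      Filter.atTop (nhds 1) := by
  obtain ⟨n, rfl⟩ := Nat.exists_eq_add_of_le' hk
  have hc : a₁ + 1 ≠ 0 := fun h => ha₁ (eq_neg_of_add_eq_zero_left h)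
  have h := (((hasScaledJet_factor hc (a₀ + b₀ - 2) (a₀ - 1) n).prod_shift
    (n + 1)).tendsto_iterate_fwdDiff (-n)).const_mul (((n + 1).factorial : ℝ)⁻¹)
  have hlim : ((n + 1).factorial : ℝ)⁻¹ *
      (Polynomial.derivative^[n] (Polynomial.X ^ (n + 1) : Polynomial ℝ)).eval 1 = 1 := by
    rw [Polynomial.iterate_derivative_X_pow_eq_smul]
    have : (n + 1).descFactorial n = (n + 1).factorial := by
      have := Nat.factorial_mul_descFactorial (Nat.le_succ n)
      simpa using this
    rw [this]
    simp [Nat.factorial_ne_zero]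
  rw [hlim] at h
  refine h.congr' ?_
  filter_upwards [Filter.eventually_ne_atTop 0] with N hN
  have hN' : (N : ℝ) ≠ 0 := Nat.cast_ne_zero.2 hN
  rw [iterate_fwdDiff_neg_eq_sum, Rk, mul_div_assoc, sum_div, mul_sum]
  congr 1
  refine sum_congr rfl fun i _ => ?_
  rw [prod_div_distrib, prod_const, card_range, Nat.add_sub_cancel, pow_succ]
  have : ∏ m ∈ range (n + 1), ((N : ℝ) + ((-(i : ℤ) + (m : ℤ) : ℤ) : ℝ)) *
        ((a₁ + 1) * N + (a₀ - 1 + ((-(i : ℤ) + (m : ℤ) : ℤ) : ℝ))) /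
        ((a₁ + 1) * N + (a₀ + b₀ - 2 + ((-(i : ℤ) + (m : ℤ) : ℤ) : ℝ))) =
      ∏ m ∈ range (n + 1), (((N : ℝ) + ((m : ℝ) - (i : ℝ))) *
        (a₁ * (N : ℝ) + a₀ + (N : ℝ) + ((m : ℝ) - (i : ℝ)) - 1)) /
          (a₁ * (N : ℝ) + a₀ + (-(N : ℝ) + b₀) + 2 * (N : ℝ) + ((m : ℝ) - (i : ℝ)) - 2) := by
    refine prod_congr rfl fun m _ => ?_
    push_cast
    congr 1 <;> ring
  rw [this]
  field_simp
end

section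
/- For all natural numbers a, b, c, the integer identity Σ_{j=0}^{a} (−1)^j · binom(a,j) · binom(c+j, b+j) = (−1)^a · binom(c, a+b) holds. -/
open Finset

/-- Pascal's rule for alternating binomial sums. -/
theorem sum_neg_one_pow_mul_choose_succ (a : ℕ) (f : ℕ → ℤ) :
    ∑ j ∈ Finset.range (a + 2), (-1 : ℤ) ^ j * ((a + 1).choose j : ℤ) * f j =
      ∑ j ∈ Finset.range (a + 1), (-1 : ℤ) ^ j * (a.choose j : ℤ) * f j -
        ∑ j ∈ Finset.range (a + 1), (-1 : ℤ) ^ j * (a.choose j : ℤ) * f (j + 1) := by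
  have h : ∑ j ∈ Finset.range (a + 2), (-1 : ℤ) ^ j * (a.choose j : ℤ) * f j =
      ∑ j ∈ Finset.range (a + 1), (-1 : ℤ) ^ j * (a.choose j : ℤ) * f j := by
    rw [Finset.sum_range_succ]
    simp
  rw [← h, Finset.sum_range_succ', Finset.sum_range_succ' _ (a + 1), add_sub_right_comm,
    ← Finset.sum_sub_distrib]
  congr 1
  · refine Finset.sum_congr rfl fun j _ => ?_
    rw [Nat.choose_succ_succ]
    push_cast
    ring
  · simp

theorem alternating_binom_identity (a b c : ℕ) :
    ∑ j ∈ Finset.range (a + 1),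
        (-1 : ℤ) ^ j * (a.choose j : ℤ) * ((c + j).choose (b + j) : ℤ) =
      (-1 : ℤ) ^ a * (c.choose (a + b) : ℤ) := by
  induction a generalizing b c with
  | zero => simp
  | succ a ih =>
    have shifted := ih (b + 1) (c + 1)
    simp only [add_right_comm _ 1, ← add_assoc] at shifted
    rw [sum_neg_one_pow_mul_choose_succ a fun j => ((c + j).choose (b + j) : ℤ), ih b c]
    simp only [← add_assoc]
    rw [shifted, add_right_comm a 1 b, Nat.choose_succ_succ]
    push_cast
    ring
end

section
/- For all natural numbers m ≤ n, the rational-number identity Σ_{j=0}^{n−m} (−1/2)^j · binom(n−m+j, j) · binom(2n, n+m+j) = 2^{m−n} · binom(n,m) · binom(2n,n)/binom(2m,m) holds, where 2^{m−n} denotes 1/2^{n−m}. -/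
open Finset

/-- The sum `∑ j ≤ k, (-1/2)^j * binom(k+j, j) * binom(N, k-j)`. -/
def halfChooseSum (N k : ℕ) : ℚ :=
  ∑ j ∈ range (k + 1), (-(1 : ℚ) / 2) ^ j * ((k + j).choose j : ℚ) * (N.choose (k - j) : ℚ)

lemma sum_range_halfChoose_telescope (N k J : ℕ) (hJ : J ≤ k) :
    ∑ j ∈ range J, (((N : ℚ) - 2 * k + 1) *
        ((-(1 : ℚ) / 2) ^ j * ((k + j).choose j : ℚ) * ((N + 2).choose (k - j) : ℚ)) -
        (N + 1) * ((-(1 : ℚ) / 2) ^ j * ((k + j).choose j : ℚ) * (N.choose (k - j) : ℚ))) =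
      2 * J * (-(1 : ℚ) / 2) ^ J * ((k + J).choose J : ℚ) * ((N + 1).choose (k - J) : ℚ) := by
  induction J with
  | zero => simp
  | succ j ih =>
    rw [sum_range_succ, ih (by omega)]
    obtain ⟨i, rfl⟩ : ∃ i, k = i + 1 + j := ⟨k - 1 - j, by omega⟩
    rw [show i + 1 + j - j = i + 1 by omega, show i + 1 + j - (j + 1) = i by omega,
      show i + 1 + j + (j + 1) = i + 1 + j + j + 1 by omega]
    have hA : ((i + 1 + j + j : ℕ) + 1 : ℚ) * ((i + 1 + j + j).choose j : ℚ) =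
        ((i + 1 + j + j + 1).choose (j + 1) : ℚ) * (j + 1) :=
      mod_cast Nat.add_one_mul_choose_eq (i + 1 + j + j) j
    have hN : ((N : ℚ) + 1) * (N.choose i : ℚ) = ((N + 1).choose (i + 1) : ℚ) * (i + 1) :=
      mod_cast Nat.add_one_mul_choose_eq N i
    have hQ : ((N + 1).choose (i + 1) : ℚ) = N.choose i + N.choose (i + 1) :=
      mod_cast Nat.choose_succ_succ N i
    have hP : ((N : ℚ) + 1 + 1) * ((N + 1).choose i : ℚ) =
        ((N + 2).choose (i + 1) : ℚ) * (i + 1) :=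
      mod_cast Nat.add_one_mul_choose_eq (N + 1) i
    have hR : ((N + 2).choose (i + 1) : ℚ) = (N + 1).choose i + (N + 1).choose (i + 1) :=
      mod_cast Nat.choose_succ_succ (N + 1) i
    rw [hR] at hP ⊢
    have hM : ((N : ℚ) + 1) * (N.choose (i + 1) : ℚ) =
        (N - i) * ((N + 1).choose (i + 1) : ℚ) := by
      linear_combination -(N + 1 : ℚ) * hQ - hN
    push_cast at hA ⊢
    rw [pow_succ]
    generalize ((i + 1 + j + j).choose j : ℚ) = A at *
    generalize ((N + 1).choose i : ℚ) = P at *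
    generalize ((N + 1).choose (i + 1) : ℚ) = Q at *
    generalize (-(1 : ℚ) / 2) ^ j = x at *
    linear_combination x * A * hP - x * A * hM - x * P * hA

lemma halfChooseSum_add_two (N k : ℕ) :
    ((N : ℚ) - 2 * k + 1) * halfChooseSum (N + 2) k = (N + 1) * halfChooseSum N k := by
  have h := sum_range_halfChoose_telescope N k k le_rfl
  rw [sum_sub_distrib, ← mul_sum, ← mul_sum] at h
  unfold halfChooseSum
  rw [sum_range_succ, sum_range_succ]
  simp only [Nat.sub_self, Nat.choose_zero_right, Nat.cast_one] at h ⊢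
  linear_combination h

lemma halfChooseSum_two_mul_self (k : ℕ) :
    halfChooseSum (2 * k) k = 1 / 2 ^ k * ((2 * k).choose k : ℚ) := by
  have hb := add_pow (-(1 : ℚ) / 2) 1 k
  rw [show (-(1 : ℚ) / 2) + 1 = 1 / 2 by norm_num, div_pow, one_pow] at hb
  rw [hb, halfChooseSum, sum_mul]
  refine sum_congr rfl fun j hj => ?_
  have hj' : j ≤ k := by simpa [Nat.lt_succ_iff] using hj
  have h := Nat.choose_mul (n := 2 * k) (k := k + j) (s := k) (by omega)
  rw [show 2 * k - k = k by omega, show k + j - k = j by omega,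
    ← Nat.choose_symm (show k + j ≤ 2 * k by omega), show 2 * k - (k + j) = k - j by omega,
    Nat.choose_symm_add] at h
  have h' : ((2 * k).choose (k - j) : ℚ) * ((k + j).choose j : ℚ) =
      ((2 * k).choose k : ℚ) * (k.choose j : ℚ) := mod_cast h
  rw [one_pow]
  linear_combination (-(1 : ℚ) / 2) ^ j * h'

lemma halfChooseSum_mul_centralBinom (m k : ℕ) :
    halfChooseSum (2 * (m + k)) k * (m.centralBinom : ℚ) =
      1 / 2 ^ k * ((m + k).choose m : ℚ) * ((m + k).centralBinom : ℚ) := by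
  induction m with
  | zero => simp [halfChooseSum_two_mul_self, Nat.centralBinom]
  | succ m ih =>
    have hS := halfChooseSum_add_two (2 * (m + k)) k
    rw [show 2 * (m + k) + 2 = 2 * (m + 1 + k) by ring] at hS
    have h1 : ((m : ℚ) + 1) * ((m + 1).centralBinom : ℚ) =
        2 * (2 * m + 1) * (m.centralBinom : ℚ) := mod_cast Nat.succ_mul_centralBinom_succ m
    have h2 : ((m : ℚ) + k + 1) * ((m + 1 + k).centralBinom : ℚ) =
        2 * (2 * (m + k) + 1) * ((m + k).centralBinom : ℚ) := by
      rw [show m + 1 + k = m + k + 1 by ring]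
      exact_mod_cast Nat.succ_mul_centralBinom_succ (m + k)
    have h3 : ((m : ℚ) + k + 1) * ((m + k).choose m : ℚ) =
        ((m + 1 + k).choose (m + 1) : ℚ) * (m + 1) := by
      rw [show m + 1 + k = m + k + 1 by ring]
      exact_mod_cast Nat.add_one_mul_choose_eq (m + k) m
    have hm : (m : ℚ) + 1 ≠ 0 := by positivity
    push_cast at hS
    apply mul_left_cancel₀ hm
    linear_combination halfChooseSum (2 * (m + 1 + k)) k * h1 +
      2 * (m.centralBinom : ℚ) * hS + 2 * (2 * (m + k) + 1) * ih +
      1 / 2 ^ k * ((m + 1 + k).centralBinom : ℚ) * h3 -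
      1 / 2 ^ k * ((m + k).choose m : ℚ) * h2

theorem central_binomial_identity (m n : ℕ) (hmn : m ≤ n) :
    ∑ j ∈ Finset.range (n - m + 1),
        (-(1 : ℚ) / 2) ^ j * ((n - m + j).choose j : ℚ) * ((2 * n).choose (n + m + j) : ℚ) =
      (1 / 2 ^ (n - m)) * (n.choose m : ℚ) * ((2 * n).choose n : ℚ) / ((2 * m).choose m : ℚ) := by
  obtain ⟨k, rfl⟩ := Nat.exists_eq_add_of_le hmn
  rw [Nat.add_sub_cancel_left]
  have h0 : ((2 * m).choose m : ℚ) ≠ 0 := mod_cast (Nat.choose_pos (by omega)).ne'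
  rw [eq_div_iff h0]
  refine Eq.trans ?_ (halfChooseSum_mul_centralBinom m k)
  rw [halfChooseSum, Nat.centralBinom]
  congr 1
  refine sum_congr rfl fun j hj => ?_
  have hj' : j ≤ k := by simpa [Nat.lt_succ_iff] using hj
  rw [← Nat.choose_symm (show m + k + m + j ≤ 2 * (m + k) by omega),
    show 2 * (m + k) - (m + k + m + j) = k - j by omega]
end
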